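/- Let f : [0,∞) → ℝ be m-convex for some m ∈ (0,1], with 0 ≤ a < b and f integrable on [a,b]. For x, y ≥ 0 and t ∈ [0,1], define F(x,y)_(t) = (1/2)·[f(tx + m(1−t)y) + f((1−t)x + mty)]. Then for every α > 0: (1/(b−a)^α) ∫_a^b (b−u)^{α−1} F(u, (a+b)/2)_{((b−u)/(b−a))} du ≤ (Γ(α)/(2(b−a)^α)) · J_{a+}^α f(b) + (m/(2α)) · f((a+b)/2), where J_{a+}^α f(b) = (1/Γ(α)) ∫_a^b (b−t)^{α−1} f(t) dt. -/

import Mathlib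

open MeasureTheory intervalIntegral Real

/-- `f` is `m`-convex on `[0, ∞)`. -/
def IsMConvex (m : ℝ) (f : ℝ → ℝ) : Prop :=
  ∀ x, 0 ≤ x → ∀ y, 0 ≤ y → ∀ t ∈ Set.Icc (0 : ℝ) 1,
    f (t * x + m * (1 - t) * y) ≤ t * f x + m * (1 - t) * f y

/-- An `m`-convex function becomes star-shaped after subtracting `m * f 0`, so its slope from
the origin is monotone; the substitution `x = exp s` makes it monotone on all of `ℝ`. -/
theorem IsMConvex.monotone_slope_exp {m : ℝ} {f : ℝ → ℝ} (hf : IsMConvex m f) :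
    Monotone fun s : ℝ => (f (Real.exp s) - m * f 0) / Real.exp s := by
  intro s r hsr
  have hs := Real.exp_pos s
  have hr := Real.exp_pos r
  have h := hf (Real.exp r) hr.le 0 le_rfl (Real.exp s / Real.exp r)
    ⟨by positivity, (div_le_one hr).2 (Real.exp_le_exp.2 hsr)⟩
  rw [mul_zero, add_zero, div_mul_cancel₀ _ hr.ne'] at h
  simp only
  rw [div_le_iff₀ hs]
  calc f (Real.exp s) - m * f 0
      ≤ Real.exp s / Real.exp r * f (Real.exp r)
          + m * (1 - Real.exp s / Real.exp r) * f 0 - m * f 0 := by linarith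
    _ = (f (Real.exp r) - m * f 0) / Real.exp r * Real.exp s := by ring

/-- An `m`-convex function agrees on `[0, ∞)` with a Borel function. -/
theorem IsMConvex.exists_measurable_eqOn {m : ℝ} {f : ℝ → ℝ} (hf : IsMConvex m f) :
    ∃ g : ℝ → ℝ, Measurable g ∧ ∀ x, 0 ≤ x → g x = f x := by
  classical
  refine ⟨fun x => if 0 < x then
    x * ((f (Real.exp (Real.log x)) - m * f 0) / Real.exp (Real.log x)) + m * f 0 else f 0, ?_, ?_⟩
  · refine Measurable.ite measurableSet_Ioi ?_ measurable_const
    exact (measurable_id.mul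
      (hf.monotone_slope_exp.measurable.comp Real.measurable_log)).add_const _
  · intro x hx
    rcases hx.eq_or_lt with rfl | hx
    · simp
    · simp only [hx, if_true, Real.exp_log hx]
      field_simp
      ring

/-- An `m`-convex function with `0 < m` is bounded on compact subintervals of `[0, ∞)`. -/
theorem IsMConvex.exists_abs_le {m : ℝ} {f : ℝ → ℝ} (hf : IsMConvex m f) (hm0 : 0 < m)
    (hm1 : m ≤ 1) {R : ℝ} (hR : 0 < R) :
    ∃ C, ∀ x ∈ Set.Icc 0 R, |f x| ≤ C := by
  have upper : ∀ S, 0 < S → ∀ x ∈ Set.Icc 0 S, f x ≤ |f S| + |f 0| := by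
    intro S hS x hx
    have h0 : 0 ≤ x / S := div_nonneg hx.1 hS.le
    have h1 : x / S ≤ 1 := (div_le_one hS).2 hx.2
    have h := hf S hS.le 0 le_rfl (x / S) ⟨h0, h1⟩
    rw [mul_zero, add_zero, div_mul_cancel₀ _ hS.ne'] at h
    have h2 : x / S * f S ≤ |f S| :=
      (mul_le_mul_of_nonneg_left (le_abs_self _) h0).trans
        (mul_le_of_le_one_left (abs_nonneg _) h1)
    have h3 : m * (1 - x / S) * f 0 ≤ |f 0| :=
      (mul_le_mul_of_nonneg_left (le_abs_self _)
        (mul_nonneg hm0.le (sub_nonneg.2 h1))).trans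
        (mul_le_of_le_one_left (abs_nonneg _)
          (mul_le_one₀ hm1 (sub_nonneg.2 h1) (by linarith)))
    linarith
  have hS : 0 < 2 * R / m := by positivity
  refine ⟨(|f R| + |f 0|) + (2 * |f R| + (|f (2 * R / m)| + |f 0|)), fun x hx => ?_⟩
  have hy0 : 0 ≤ (2 * R - x) / m := div_nonneg (by linarith [hx.2]) hm0.le
  have hy1 : (2 * R - x) / m ≤ 2 * R / m := by
    gcongr
    linarith [hx.1]
  have hy := upper _ hS _ ⟨hy0, hy1⟩
  have h := hf x hx.1 _ hy0 (1 / 2) ⟨by norm_num, by norm_num⟩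
  have hc : 1 / 2 * x + m * (1 - 1 / 2) * ((2 * R - x) / m) = R := by
    field_simp
    ring
  rw [hc] at h
  have hmy : m * f ((2 * R - x) / m) ≤ |f (2 * R / m)| + |f 0| :=
    (mul_le_mul_of_nonneg_left hy hm0.le).trans
      (mul_le_of_le_one_left (by positivity) hm1)
  have hx' := upper R hR x hx
  have := neg_abs_le (f R)
  have := abs_nonneg (f R)
  have := abs_nonneg (f 0)
  have := abs_nonneg (f (2 * R / m))
  rw [abs_le]
  constructor <;> linarith

theorem intervalIntegrable_sub_rpow {a b α : ℝ} (hα : 0 < α) :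
    IntervalIntegrable (fun u => (b - u) ^ (α - 1)) volume a b := by
  have h := (intervalIntegral.intervalIntegrable_rpow' (a := b - a) (b := 0) (r := α - 1)
    (by linarith)).comp_sub_left b
  simpa using h

theorem integral_sub_rpow {a b α : ℝ} (hα : 0 < α) :
    ∫ u in a..b, (b - u) ^ (α - 1) = (b - a) ^ α / α := by
  rw [intervalIntegral.integral_comp_sub_left (fun x => x ^ (α - 1)) b, sub_self,
    integral_rpow (Or.inl (by linarith)), sub_add_cancel, Real.zero_rpow hα.ne', sub_zero]

/-- The fractional kernel times an `m`-convex function of a measurable argument is integrable. -/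
theorem IsMConvex.intervalIntegrable_sub_rpow_mul_comp {a b m α : ℝ} {f φ : ℝ → ℝ}
    (hf : IsMConvex m f) (hm0 : 0 < m) (hm1 : m ≤ 1) (hα : 0 < α) (hb : 0 < b) (hab : a ≤ b)
    (hφ : Measurable φ) (hmaps : ∀ u ∈ Set.Icc a b, φ u ∈ Set.Icc 0 b) :
    IntervalIntegrable (fun u => (b - u) ^ (α - 1) * f (φ u)) volume a b := by
  obtain ⟨g, hg, hgf⟩ := hf.exists_measurable_eqOn
  obtain ⟨C, hC⟩ := hf.exists_abs_le hm0 hm1 hb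
  have hw := intervalIntegrable_sub_rpow (a := a) (b := b) hα
  rw [intervalIntegrable_iff_integrableOn_Ioc_of_le hab] at hw ⊢
  refine Integrable.mul_bdd (c := C) hw ?_ ?_
  · refine (hg.comp hφ).aestronglyMeasurable.congr ?_
    filter_upwards [ae_restrict_mem measurableSet_Ioc] with u hu
    exact hgf _ (hmaps u (Set.Ioc_subset_Icc_self hu)).1
  · filter_upwards [ae_restrict_mem measurableSet_Ioc] with u hu
    exact hC _ (hmaps u (Set.Ioc_subset_Icc_self hu))

/-- Hadamard type fractional inequality involving the two-point average
`F(x,y)_(t) = (f(tx + m(1−t)y) + f((1−t)x + mty)) / 2` for an `m`-convex function. -/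
theorem mConvex_fractional_F_inequality
    (a b m α : ℝ) (f : ℝ → ℝ)
    (ha : 0 ≤ a) (hab : a < b)
    (hint : IntervalIntegrable f volume a b)
    (hm0 : 0 < m) (hm1 : m ≤ 1)
    (hconv : ∀ x, 0 ≤ x → ∀ y, 0 ≤ y → ∀ t ∈ Set.Icc (0:ℝ) 1,
      f (t * x + m * (1 - t) * y) ≤ t * f x + m * (1 - t) * f y)
    (hα : 0 < α)
    (F : ℝ → ℝ → ℝ → ℝ)
    (hF : ∀ x y t, F x y t =
      1 / 2 * (f (t * x + m * (1 - t) * y) + f ((1 - t) * x + m * t * y))) :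
    (1 / (b - a) ^ α) *
        (∫ u in a..b, (b - u) ^ (α - 1) * F u ((a + b) / 2) ((b - u) / (b - a))) ≤
      Real.Gamma α / (2 * (b - a) ^ α) *
          ((1 / Real.Gamma α) * ∫ t in a..b, (b - t) ^ (α - 1) * f t) +
        m / (2 * α) * f ((a + b) / 2) := by
  have hf : IsMConvex m f := hconv
  have hba : 0 < b - a := sub_pos.2 hab
  have hb : 0 < b := ha.trans_lt hab
  set y := (a + b) / 2 with hy
  have hy0 : 0 ≤ y := by rw [hy]; linarith
  have hyb : y ≤ b := by rw [hy]; linarith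
  have ht : ∀ u ∈ Set.Icc a b, (b - u) / (b - a) ∈ Set.Icc (0 : ℝ) 1 := fun u hu =>
    ⟨div_nonneg (by linarith [hu.2]) hba.le, (div_le_one hba).2 (by linarith [hu.1])⟩
  have hmem : ∀ u ∈ Set.Icc a b, ∀ t ∈ Set.Icc (0 : ℝ) 1,
      t * u + m * (1 - t) * y ∈ Set.Icc 0 b := by
    intro u hu t ht
    have hu0 : 0 ≤ u := ha.trans hu.1
    have h1t : 0 ≤ 1 - t := sub_nonneg.2 ht.2
    have ht0 := ht.1
    refine ⟨by positivity, ?_⟩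
    have h1 : t * u ≤ t * b := mul_le_mul_of_nonneg_left hu.2 ht0
    have h2 : m * (1 - t) * y ≤ (1 - t) * b :=
      mul_le_mul (mul_le_of_le_one_left h1t hm1) hyb hy0 h1t
    linarith
  have hsymm : ∀ t ∈ Set.Icc (0 : ℝ) 1, 1 - t ∈ Set.Icc (0 : ℝ) 1 := fun t ht =>
    ⟨sub_nonneg.2 ht.2, by linarith [ht.1]⟩
  have hint₁ : IntervalIntegrable (fun u => (b - u) ^ (α - 1) *
      f ((b - u) / (b - a) * u + m * (1 - (b - u) / (b - a)) * y)) volume a b :=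
    hf.intervalIntegrable_sub_rpow_mul_comp hm0 hm1 hα hb hab.le (by fun_prop)
      fun u hu => hmem u hu _ (ht u hu)
  have hint₂ : IntervalIntegrable (fun u => (b - u) ^ (α - 1) *
      f ((1 - (b - u) / (b - a)) * u + m * ((b - u) / (b - a)) * y)) volume a b :=
    hf.intervalIntegrable_sub_rpow_mul_comp hm0 hm1 hα hb hab.le (by fun_prop)
      fun u hu => by simpa using hmem u hu _ (hsymm _ (ht u hu))
  have hintF : IntervalIntegrable
      (fun u => (b - u) ^ (α - 1) * F u y ((b - u) / (b - a))) volume a b := by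
    refine ((hint₁.add hint₂).const_mul (1 / 2)).congr fun u _ => ?_
    simp only [hF]
    ring
  have hintf : IntervalIntegrable (fun u => (b - u) ^ (α - 1) * f u) volume a b :=
    hf.intervalIntegrable_sub_rpow_mul_comp hm0 hm1 hα hb hab.le measurable_id
      fun u hu => ⟨ha.trans hu.1, hu.2⟩
  have hw := intervalIntegrable_sub_rpow (a := a) (b := b) hα
  have key : ∫ u in a..b, (b - u) ^ (α - 1) * F u y ((b - u) / (b - a)) ≤
      1 / 2 * (∫ u in a..b, (b - u) ^ (α - 1) * f u) +
        m * f y / 2 * ((b - a) ^ α / α) := by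
    rw [← integral_sub_rpow hα, ← intervalIntegral.integral_const_mul,
      ← intervalIntegral.integral_const_mul,
      ← intervalIntegral.integral_add (hintf.const_mul _) (hw.const_mul _)]
    refine intervalIntegral.integral_mono_on hab.le hintF
      ((hintf.const_mul _).add (hw.const_mul _)) fun u hu => ?_
    have hu0 : 0 ≤ u := ha.trans hu.1
    have h1 := hf u hu0 y hy0 _ (ht u hu)
    have h2 := hf u hu0 y hy0 _ (hsymm _ (ht u hu))
    rw [sub_sub_cancel] at h2
    have hFle : F u y ((b - u) / (b - a)) ≤ 1 / 2 * (f u + m * f y) := by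
      rw [hF]
      linarith
    have hw0 : 0 ≤ (b - u) ^ (α - 1) := Real.rpow_nonneg (sub_nonneg.2 hu.2) _
    calc _ ≤ (b - u) ^ (α - 1) * (1 / 2 * (f u + m * f y)) :=
          mul_le_mul_of_nonneg_left hFle hw0
      _ = _ := by ring
  have hp : 0 < (b - a) ^ α := Real.rpow_pos_of_pos hba α
  have hΓ := (Real.Gamma_pos_of_pos hα).ne'
  refine (mul_le_mul_of_nonneg_left key (one_div_pos.2 hp).le).trans_eq ?_
  field_simp
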